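/- Let f(x,y,z) = (x, y, Q₁(x,y,z), Q₂(x,y,z), Q₃(x,y,z)) where Q₁, Q₂, Q₃ are homogeneous quadratic polynomials, and let α be the 3×3 real matrix whose i-th row consists of the coefficients of z², xz and yz in Qᵢ. Then f is A²-equivalent to g₁(x,y,z) = (x,y,xz,yz,z²) if and only if det α ≠ 0. -/

import Mathlib

noncomputable section

/-- Two smooth map germs `(ℝ³,0) → (ℝ⁵,0)` are `𝒜²`-equivalent: there are smooth
changes of coordinates in source and target, fixing the origin and with invertible
differential at the origin, such that the composites have the same 2-jet at `0`. -/
def A2Equiv (f g : (Fin 3 → ℝ) → (Fin 5 → ℝ)) : Prop :=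
  ∃ (ψ : (Fin 3 → ℝ) → (Fin 3 → ℝ)) (φ : (Fin 5 → ℝ) → (Fin 5 → ℝ))
    (ψ' : (Fin 3 → ℝ) ≃L[ℝ] (Fin 3 → ℝ)) (φ' : (Fin 5 → ℝ) ≃L[ℝ] (Fin 5 → ℝ)),
    ContDiff ℝ (⊤ : ℕ∞) ψ ∧ ContDiff ℝ (⊤ : ℕ∞) φ ∧ ψ 0 = 0 ∧ φ 0 = 0 ∧
    HasFDerivAt ψ (ψ' : (Fin 3 → ℝ) →L[ℝ] (Fin 3 → ℝ)) 0 ∧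
    HasFDerivAt φ (φ' : (Fin 5 → ℝ) →L[ℝ] (Fin 5 → ℝ)) 0 ∧
    ∀ k : ℕ, k ≤ 2 → iteratedFDeriv ℝ k (φ ∘ f ∘ ψ) 0 = iteratedFDeriv ℝ k g 0

def g1 : (Fin 3 → ℝ) → (Fin 5 → ℝ) := fun p => ![p 0, p 1, p 0 * p 2, p 1 * p 2, p 2 ^ 2]
def g2 : (Fin 3 → ℝ) → (Fin 5 → ℝ) := fun p => ![p 0, p 1, p 2 ^ 2, p 0 * p 2, 0]
def g3 : (Fin 3 → ℝ) → (Fin 5 → ℝ) := fun p => ![p 0, p 1, p 0 * p 2, p 1 * p 2, 0]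
def g4 : (Fin 3 → ℝ) → (Fin 5 → ℝ) := fun p => ![p 0, p 1, p 2 ^ 2, 0, 0]
def g5 : (Fin 3 → ℝ) → (Fin 5 → ℝ) := fun p => ![p 0, p 1, p 0 * p 2, 0, 0]
def g6 : (Fin 3 → ℝ) → (Fin 5 → ℝ) := fun p => ![p 0, p 1, 0, 0, 0]

open Matrix

/-- The corank one map `(x, y, Q₁, Q₂, Q₃)` in Monge form. The rows of `c` are the coefficients of
`x², xy, y²` in the `Qᵢ`, those of `α` the coefficients of `z², xz, yz`. -/
def mongeMap (c : Fin 3 → Fin 3 → ℝ) (α : Matrix (Fin 3) (Fin 3) ℝ)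
    (p : Fin 3 → ℝ) : Fin 5 → ℝ :=
  let q : Fin 3 → ℝ := fun i => c i 0 * p 0 ^ 2 + c i 1 * p 0 * p 1 + c i 2 * p 1 ^ 2
        + α i 0 * p 2 ^ 2 + α i 1 * p 0 * p 2 + α i 2 * p 1 * p 2
  ![p 0, p 1, q 0, q 1, q 2]

theorem g1_eq_mongeMap : g1 = mongeMap 0 !![0, 1, 0; 0, 0, 1; 1, 0, 0] := by
  funext p i
  fin_cases i <;> simp [g1, mongeMap]

theorem contDiff_mongeMap (c : Fin 3 → Fin 3 → ℝ) (α : Matrix (Fin 3) (Fin 3) ℝ)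
    {n : WithTop ℕ∞} : ContDiff ℝ n (mongeMap c α) := by
  rw [contDiff_pi]
  intro i
  fin_cases i <;> simp [mongeMap] <;> fun_prop

/-- The directional derivatives of a map are its derivatives along lines. -/
theorem fderiv_apply_eq_of_hasDerivAt_line {E F : Type*} [NormedAddCommGroup E]
    [NormedSpace ℝ E] [NormedAddCommGroup F] [NormedSpace ℝ F] {f : E → F} {p w : E} {d : F}
    (hf : DifferentiableAt ℝ f p) (h : HasDerivAt (fun s : ℝ => f (p + s • w)) d 0) :
    fderiv ℝ f p w = d := by
  have h' := hf.hasFDerivAt.hasLineDerivAt w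
  exact HasDerivAt.unique h' h

theorem fderiv_mongeMap_zero (c : Fin 3 → Fin 3 → ℝ) (α : Matrix (Fin 3) (Fin 3) ℝ)
    (v : Fin 3 → ℝ) : fderiv ℝ (mongeMap c α) 0 v = ![v 0, v 1, 0, 0, 0] := by
  refine fderiv_apply_eq_of_hasDerivAt_line
    ((contDiff_mongeMap c α (n := 1)).differentiable (by simp) 0) ?_
  rw [hasDerivAt_pi]
  have key : ∀ a : ℝ, HasDerivAt (fun s : ℝ => s * a) a 0 := fun a => by
    simpa using (hasDerivAt_id (0 : ℝ)).mul_const a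
  have key2 : ∀ a : ℝ, HasDerivAt (fun s : ℝ => s ^ 2 * a) 0 0 := fun a => by
    simpa using (hasDerivAt_pow 2 (0 : ℝ)).mul_const a
  have hq : ∀ i : Fin 3, HasDerivAt (fun s : ℝ => c i 0 * (s * v 0) ^ 2
      + c i 1 * (s * v 0) * (s * v 1) + c i 2 * (s * v 1) ^ 2 + α i 0 * (s * v 2) ^ 2
      + α i 1 * (s * v 0) * (s * v 2) + α i 2 * (s * v 1) * (s * v 2)) 0 0 := fun i => by
    convert key2 (c i 0 * v 0 ^ 2 + c i 1 * v 0 * v 1 + c i 2 * v 1 ^ 2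
        + α i 0 * v 2 ^ 2 + α i 1 * v 0 * v 2 + α i 2 * v 1 * v 2) using 2
    ring
  intro i
  fin_cases i
  · simpa [mongeMap] using key (v 0)
  · simpa [mongeMap] using key (v 1)
  · simpa [mongeMap] using hq 0
  · simpa [mongeMap] using hq 1
  · simpa [mongeMap] using hq 2

theorem fderiv_mongeMap_apply_z (c : Fin 3 → Fin 3 → ℝ) (α : Matrix (Fin 3) (Fin 3) ℝ)
    (p : Fin 3 → ℝ) : fderiv ℝ (mongeMap c α) p ![0, 0, 1] =
      vecCons 0 (vecCons 0 (α *ᵥ ![2 * p 2, p 0, p 1])) := by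
  refine fderiv_apply_eq_of_hasDerivAt_line
    ((contDiff_mongeMap c α (n := 1)).differentiable (by simp) p) ?_
  rw [hasDerivAt_pi]
  have hq : ∀ i : Fin 3, HasDerivAt (fun s : ℝ => c i 0 * p 0 ^ 2
      + c i 1 * p 0 * p 1 + c i 2 * p 1 ^ 2 + α i 0 * (p 2 + s) ^ 2
      + α i 1 * p 0 * (p 2 + s) + α i 2 * p 1 * (p 2 + s))
      (α i 0 * (2 * p 2) + α i 1 * p 0 + α i 2 * p 1) 0 := fun i => by
    have h : HasDerivAt (fun s : ℝ => p 2 + s) 1 0 := (hasDerivAt_id (0 : ℝ)).const_add _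
    have h1 := ((((h.pow 2).const_mul (α i 0)).const_add (c i 0 * p 0 ^ 2
      + c i 1 * p 0 * p 1 + c i 2 * p 1 ^ 2)).add (h.const_mul (α i 1 * p 0))).add
      (h.const_mul (α i 2 * p 1))
    exact h1.congr_deriv (by simp)
  intro i
  fin_cases i
  · simpa [mongeMap] using hasDerivAt_const (0 : ℝ) (p 0)
  · simpa [mongeMap] using hasDerivAt_const (0 : ℝ) (p 1)
  · simpa [mongeMap, mulVec, dotProduct, Fin.sum_univ_three] using hq 0
  · simpa [mongeMap, mulVec, dotProduct, Fin.sum_univ_three] using hq 1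
  · simpa [mongeMap, mulVec, dotProduct, Fin.sum_univ_three] using hq 2

theorem ContDiff.hasFDerivAt_fderiv {E F : Type*} [NormedAddCommGroup E]
    [NormedSpace ℝ E] [NormedAddCommGroup F] [NormedSpace ℝ F] {f : E → F}
    (hf : ContDiff ℝ 2 f) (x : E) :
    HasFDerivAt (fderiv ℝ f) (fderiv ℝ (fderiv ℝ f) x) x :=
  ((hf.fderiv_right (m := 1) (by norm_num)).differentiable (by simp) x).hasFDerivAt

theorem fderiv_fderiv_mongeMap_apply_z (c : Fin 3 → Fin 3 → ℝ) (α : Matrix (Fin 3) (Fin 3) ℝ)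
    (v : Fin 3 → ℝ) : fderiv ℝ (fderiv ℝ (mongeMap c α)) 0 v ![0, 0, 1] =
      vecCons 0 (vecCons 0 (α *ᵥ ![2 * v 2, v 0, v 1])) := by
  have h := (((contDiff_mongeMap c α).hasFDerivAt_fderiv 0).clm_apply
    (hasFDerivAt_const (![0, 0, 1] : Fin 3 → ℝ) (0 : Fin 3 → ℝ))).hasLineDerivAt v
  simp only [HasLineDerivAt, fderiv_mongeMap_apply_z] at h
  have h2 : HasDerivAt (fun s : ℝ => s • (vecCons 0 (vecCons 0 (α *ᵥ ![2 * v 2, v 0, v 1])) :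
      Fin 5 → ℝ)) (vecCons 0 (vecCons 0 (α *ᵥ ![2 * v 2, v 0, v 1]))) 0 := by
    simpa using (hasDerivAt_id (0 : ℝ)).smul_const
      (vecCons 0 (vecCons 0 (α *ᵥ ![2 * v 2, v 0, v 1])) : Fin 5 → ℝ)
  have h3 := h.unique (h2.congr_of_eventuallyEq (.of_forall fun s => ?_))
  · simpa using h3
  · simp only [smul_cons, ← mulVec_smul, smul_eq_mul, mul_zero]
    simp [mul_left_comm]

/-- The second derivative of a composition. -/
theorem fderiv_fderiv_comp_apply {E F G : Type*} [NormedAddCommGroup E] [NormedSpace ℝ E]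
    [NormedAddCommGroup F] [NormedSpace ℝ F] [NormedAddCommGroup G] [NormedSpace ℝ G]
    {g : F → G} {f : E → F} (hg : ContDiff ℝ 2 g) (hf : ContDiff ℝ 2 f) (x u v : E) :
    fderiv ℝ (fderiv ℝ (g ∘ f)) x u v =
      fderiv ℝ (fderiv ℝ g) (f x) (fderiv ℝ f x u) (fderiv ℝ f x v) +
        fderiv ℝ g (f x) (fderiv ℝ (fderiv ℝ f) x u v) := by
  have hf1 : Differentiable ℝ f := hf.differentiable (by simp)
  have hg1 : Differentiable ℝ g := hg.differentiable (by simp)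
  have h : fderiv ℝ (g ∘ f) = fun y => (fderiv ℝ g (f y)).comp (fderiv ℝ f y) :=
    funext fun y => fderiv_comp y (hg1 _) (hf1 _)
  have h2 := ((hg.hasFDerivAt_fderiv (f x)).comp x (hf1 x).hasFDerivAt).clm_comp
    (hf.hasFDerivAt_fderiv x)
  rw [h]
  erw [h2.fderiv]
  simp [add_comm]

theorem det_ne_zero_of_A2Equiv_mongeMap_g1 (c : Fin 3 → Fin 3 → ℝ)
    (α : Matrix (Fin 3) (Fin 3) ℝ) (h : A2Equiv (mongeMap c α) g1) : α.det ≠ 0 := by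
  obtain ⟨ψ, φ, ψ', φ', hψ, hφ, hψ0, hφ0, hψ', hφ', hjet⟩ := h
  intro hdet
  obtain ⟨η, hη, hηα⟩ := exists_vecMul_eq_zero_iff.2 hdet
  have hψ2 : ContDiff ℝ 2 ψ := hψ.of_le (WithTop.coe_le_coe.2 le_top)
  have hφ2 : ContDiff ℝ 2 φ := hφ.of_le (WithTop.coe_le_coe.2 le_top)
  have hf2 : ContDiff ℝ 2 (mongeMap c α) := contDiff_mongeMap c α
  have hF2 : ContDiff ℝ 2 (mongeMap c α ∘ ψ) := hf2.comp hψ2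
  have hf0 : mongeMap c α 0 = 0 := by
    funext i
    fin_cases i <;> simp [mongeMap]
  have hF0 : (mongeMap c α ∘ ψ) 0 = 0 := by simp [hψ0, hf0]
  have hDF : ∀ v, fderiv ℝ (mongeMap c α ∘ ψ) 0 v = ![ψ' v 0, ψ' v 1, 0, 0, 0] := fun v => by
    rw [fderiv_comp _ (hf2.differentiable (by simp) _) (hψ2.differentiable (by simp) _), hψ0,
      ContinuousLinearMap.comp_apply, fderiv_mongeMap_zero, hψ'.fderiv]
    rfl
  have hD1 : ∀ v, φ' ![ψ' v 0, ψ' v 1, 0, 0, 0] = ![v 0, v 1, 0, 0, 0] := fun v => by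
    have h1 := congrArg (fun T => T fun _ => v) (hjet 1 (by norm_num))
    simp only [iteratedFDeriv_one_apply] at h1
    rw [fderiv_comp _ (hφ2.differentiable (by simp) _) (hF2.differentiable (by simp) _), hF0,
      ContinuousLinearMap.comp_apply, hDF, hφ'.fderiv, g1_eq_mongeMap,
      fderiv_mongeMap_zero] at h1
    exact h1
  have hψz : (![ψ' ![0, 0, 1] 0, ψ' ![0, 0, 1] 1, 0, 0, 0] : Fin 5 → ℝ) = 0 := by
    apply φ'.injective
    rw [hD1, map_zero]
    funext i
    fin_cases i <;> rfl
  have hψz' : ψ' ![0, 0, 1] = ψ' ![0, 0, 1] 2 • ![0, 0, 1] := by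
    have h0 := congrFun hψz 0
    have h1 := congrFun hψz 1
    funext i
    fin_cases i
    · simpa using h0
    · simpa using h1
    · simp
  have hD2 : ∀ v, ∃ a : Fin 3 → ℝ, φ' (ψ' ![0, 0, 1] 2 • vecCons 0 (vecCons 0
      (α *ᵥ ![2 * ψ' v 2, ψ' v 0, ψ' v 1])) + ![a 0, a 1, 0, 0, 0]) =
        ![0, 0, v 0, v 1, 2 * v 2] := fun v => by
    have h2 := congrArg (fun T => T ![v, ![0, 0, 1]]) (hjet 2 le_rfl)
    simp only [iteratedFDeriv_two_apply] at h2
    simp only [cons_val_zero, cons_val_one] at h2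
    rw [fderiv_fderiv_comp_apply hφ2 hF2, hDF ![0, 0, 1], hψz, map_zero, zero_add,
      fderiv_fderiv_comp_apply hf2 hψ2, hF0, hφ'.fderiv, hψ0, hψ'.fderiv, g1_eq_mongeMap,
      fderiv_fderiv_mongeMap_apply_z, ContinuousLinearEquiv.coe_coe,
      ContinuousLinearEquiv.coe_coe, hψz', map_smul, fderiv_fderiv_mongeMap_apply_z,
      fderiv_mongeMap_zero] at h2
    refine ⟨_, h2.trans ?_⟩
    funext i
    fin_cases i <;> simp
  have hℓ : ∀ z : Fin 5 → ℝ, η ⬝ᵥ ![z 2, z 3, z 4] = 0 := fun z => by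
    set y := φ' z with hy
    obtain ⟨a, ha⟩ := hD2 ![y 2, y 3, y 4 / 2]
    have hb := hD1 ![y 0, y 1, 0]
    have hz := ((map_add φ' _ _).trans (congrArg₂ (· + ·) ha hb)).trans (c := φ' z) (by
      rw [← hy]
      funext i
      fin_cases i <;> simp
      ring)
    have hα : ∀ w, η ⬝ᵥ (α *ᵥ w) = 0 := fun w => by rw [dotProduct_mulVec, hηα, zero_dotProduct]
    have h3 := hα (ψ' ![0, 0, 1] 2 • ![2 * ψ' ![y 2, y 3, y 4 / 2] 2,
      ψ' ![y 2, y 3, y 4 / 2] 0, ψ' ![y 2, y 3, y 4 / 2] 1])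
    refine Eq.trans ?_ h3
    rw [← φ'.injective hz, mulVec_smul]
    congr 1
    funext i
    fin_cases i <;> simp <;> rfl
  apply hη
  funext i
  fin_cases i
  · simpa [dotProduct, Fin.sum_univ_three] using hℓ ![0, 0, 1, 0, 0]
  · simpa [dotProduct, Fin.sum_univ_three] using hℓ ![0, 0, 0, 1, 0]
  · simpa [dotProduct, Fin.sum_univ_three] using hℓ ![0, 0, 0, 0, 1]

/-- The linear change of target coordinates which normalizes the coefficients of `z², xz, yz`. -/
def targetEquiv (α : Matrix (Fin 3) (Fin 3) ℝ) (hα : IsUnit α.det) :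
    (Fin 5 → ℝ) ≃ₗ[ℝ] (Fin 5 → ℝ) where
  toFun y := ![y 0, y 1, (α⁻¹ *ᵥ ![y 2, y 3, y 4]) 1, (α⁻¹ *ᵥ ![y 2, y 3, y 4]) 2,
    (α⁻¹ *ᵥ ![y 2, y 3, y 4]) 0]
  invFun y := vecCons (y 0) (vecCons (y 1) (α *ᵥ ![y 4, y 2, y 3]))
  map_add' y z := by
    funext i
    fin_cases i <;> simp [mulVec, dotProduct, Fin.sum_univ_three] <;> ring
  map_smul' r y := by
    funext i
    fin_cases i <;> simp [mulVec, dotProduct, Fin.sum_univ_three] <;> ring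
  left_inv y := by
    have h : ∀ w : Fin 3 → ℝ, ![w 0, w 1, w 2] = w := fun w => by
      funext i
      fin_cases i <;> rfl
    have h' := h (α⁻¹ *ᵥ ![y 2, y 3, y 4])
    funext i
    fin_cases i <;> simp [h', mulVec_mulVec, mul_nonsing_inv _ hα]
  right_inv y := by
    have h : ∀ w : Fin 3 → ℝ, ![w 0, w 1, w 2] = w := fun w => by
      funext i
      fin_cases i <;> rfl
    have h' := h (α *ᵥ ![y 4, y 2, y 3])
    have h2 : α⁻¹ *ᵥ (α *ᵥ ![y 4, y 2, y 3]) = ![y 4, y 2, y 3] := by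
      rw [mulVec_mulVec, nonsing_inv_mul _ hα, one_mulVec]
    rw [← h'] at h2
    funext i
    fin_cases i
    · rfl
    · rfl
    · exact congrFun h2 1
    · exact congrFun h2 2
    · exact congrFun h2 0

/-- The quadratic shear of the target given by the terms in `x², xy, y²`. -/
def targetShear (c : Fin 3 → Fin 3 → ℝ) (y : Fin 5 → ℝ) : Fin 5 → ℝ :=
  let q : Fin 3 → ℝ := fun i => c i 0 * y 0 ^ 2 + c i 1 * y 0 * y 1 + c i 2 * y 1 ^ 2
  ![y 0, y 1, y 2 - q 0, y 3 - q 1, y 4 - q 2]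

theorem contDiff_targetShear (c : Fin 3 → Fin 3 → ℝ) {n : WithTop ℕ∞} :
    ContDiff ℝ n (targetShear c) := by
  rw [contDiff_pi]
  intro i
  fin_cases i <;> simp [targetShear] <;> fun_prop

theorem hasFDerivAt_targetShear_zero (c : Fin 3 → Fin 3 → ℝ) :
    HasFDerivAt (targetShear c) (ContinuousLinearMap.id ℝ (Fin 5 → ℝ)) 0 := by
  have ha : ∀ i : Fin 5, HasFDerivAt (fun y : Fin 5 → ℝ => y i)
      (ContinuousLinearMap.proj (R := ℝ) (φ := fun _ : Fin 5 => ℝ) i) 0 :=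
    fun i => hasFDerivAt_apply i _
  have hq : ∀ (i : Fin 3) (j : Fin 5), HasFDerivAt (fun y : Fin 5 → ℝ => y j -
      (c i 0 * y 0 ^ 2 + c i 1 * y 0 * y 1 + c i 2 * y 1 ^ 2))
      (ContinuousLinearMap.proj (R := ℝ) (φ := fun _ : Fin 5 => ℝ) j) 0 := fun i j => by
    refine ((ha j).sub (((((ha 0).pow 2).const_mul (c i 0)).add
      (((ha 0).const_mul (c i 1)).mul (ha 1))).add
      (((ha 1).pow 2).const_mul (c i 2)))).congr_fderiv ?_
    ext
    simp
  rw [hasFDerivAt_pi']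
  intro i
  fin_cases i
  · exact ha 0
  · exact ha 1
  · exact hq 0 2
  · exact hq 1 3
  · exact hq 2 4

theorem targetEquiv_targetShear_mongeMap (c : Fin 3 → Fin 3 → ℝ)
    (α : Matrix (Fin 3) (Fin 3) ℝ) (hα : IsUnit α.det) (p : Fin 3 → ℝ) :
    targetEquiv α hα (targetShear c (mongeMap c α p)) = g1 p := by
  rw [← LinearEquiv.eq_symm_apply]
  funext i
  fin_cases i <;>
    simp [targetEquiv, targetShear, mongeMap, g1, mulVec, dotProduct, Fin.sum_univ_three] <;>
    ring

theorem A2Equiv_mongeMap_g1_of_det_ne_zero (c : Fin 3 → Fin 3 → ℝ)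
    (α : Matrix (Fin 3) (Fin 3) ℝ) (hα : α.det ≠ 0) : A2Equiv (mongeMap c α) g1 := by
  let L := (targetEquiv α hα.isUnit).toContinuousLinearEquiv
  refine ⟨id, L ∘ targetShear c, .refl ℝ _, L, contDiff_id,
    L.contDiff.comp (contDiff_targetShear c), rfl, ?_, hasFDerivAt_id _, ?_, fun k _ => ?_⟩
  · have h : targetShear c 0 = 0 := by
      funext i
      fin_cases i <;> simp [targetShear]
    simp [h]
  · exact (L.hasFDerivAt (x := targetShear c 0)).comp 0 (hasFDerivAt_targetShear_zero c)
  · congr 1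
    exact funext fun p => targetEquiv_targetShear_mongeMap c α hα.isUnit p

/-- A corank 1 map in Monge form whose quadratic part has `z², xz, yz` coefficient
matrix `α` of nonzero determinant is `𝒜²`-equivalent to `(x,y,xz,yz,z²)`,
and conversely. -/
theorem A2_equiv_g1_iff_det_ne_zero
    (c : Fin 3 → Fin 3 → ℝ) (α : Matrix (Fin 3) (Fin 3) ℝ)
    (Q : Fin 3 → (Fin 3 → ℝ) → ℝ)
    (hQ : ∀ i p, Q i p = c i 0 * p 0 ^ 2 + c i 1 * p 0 * p 1 + c i 2 * p 1 ^ 2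
        + α i 0 * p 2 ^ 2 + α i 1 * p 0 * p 2 + α i 2 * p 1 * p 2)
    (f : (Fin 3 → ℝ) → (Fin 5 → ℝ))
    (hf : ∀ p, f p = ![p 0, p 1, Q 0 p, Q 1 p, Q 2 p]) :
    A2Equiv f g1 ↔ α.det ≠ 0 := by
  obtain rfl : f = mongeMap c α := funext fun p => by simp [hf, hQ, mongeMap]
  exact ⟨det_ne_zero_of_A2Equiv_mongeMap_g1 c α, A2Equiv_mongeMap_g1_of_det_ne_zero c α⟩
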